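/- Let x ∈ S̃_{k+1} and suppose x = d_{A_n} ⋯ d_{A_1} where each A_m ⊊ I is nonempty, ℓ(x) = ∑_{m=1}^{n} |A_m|, and A_{m+1} ⊆ A_m − 1 for all 1 ≤ m < n (the canonical maximal decomposition). If also x = d_{B_n} ⋯ d_{B_1} where each B_m ⊊ I, ℓ(x) = ∑_{m=1}^{n} |B_m|, and |B_m| = |A_m| for every m, then B_m = A_m for every m. (Equivalently, x admits exactly one reduced decomposition into cyclically decreasing elements of its maximal shape.) -/

import Mathlib

/-- `x : Equiv.Perm ℤ` is an affine permutation in `S̃_{k+1}`: it commutes with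
translation by `k+1` and its window sums to `(k+1)(k+2)/2`. -/
def IsAffinePerm (k : ℕ) (x : Equiv.Perm ℤ) : Prop :=
  (∀ i : ℤ, x (i + (k + 1)) = x i + (k + 1)) ∧
  ∑ i ∈ Finset.Icc (1 : ℤ) (k + 1), x i = (k + 1) * (k + 2) / 2

/-- The underlying function of the simple generator `s_i`. -/
def sAffFun (k : ℕ) (i : ZMod (k + 1)) (j : ℤ) : ℤ :=
  if (j : ZMod (k + 1)) = i then j + 1
  else if (j : ZMod (k + 1)) = i + 1 then j - 1
  else j

theorem sAffFun_invol (k : ℕ) (i : ZMod (k + 1)) (h : ¬ (1 : ZMod (k + 1)) = 0) :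
    Function.Involutive (sAffFun k i) := by
  have hne : i + 1 ≠ i := fun hc => h (by
    have h2 : i + 1 = i + 0 := by simpa using hc
    exact add_left_cancel h2)
  intro j
  by_cases h1 : (j : ZMod (k + 1)) = i
  · have e1 : sAffFun k i j = j + 1 := if_pos h1
    have hj1 : ((j + 1 : ℤ) : ZMod (k + 1)) = i + 1 := by push_cast; rw [h1]
    have e2 : sAffFun k i (j + 1) = j := by
      unfold sAffFun
      rw [if_neg (by rw [hj1]; exact hne), if_pos hj1]
      ring
    rw [e1, e2]
  · by_cases h2 : (j : ZMod (k + 1)) = i + 1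
    · have e1 : sAffFun k i j = j - 1 := by unfold sAffFun; rw [if_neg h1, if_pos h2]
      have hj1 : ((j - 1 : ℤ) : ZMod (k + 1)) = i := by push_cast; rw [h2]; ring
      have e2 : sAffFun k i (j - 1) = j := by
        unfold sAffFun; rw [if_pos hj1]; ring
      rw [e1, e2]
    · have e1 : sAffFun k i j = j := by unfold sAffFun; rw [if_neg h1, if_neg h2]
      rw [e1, e1]

/-- The simple generator `s_i` of the affine symmetric group, as a permutation of `ℤ`:
it interchanges `m(k+1) + ī` and `m(k+1) + ī + 1` for every `m` (when `k ≥ 1`). -/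
noncomputable def sAff (k : ℕ) (i : ZMod (k + 1)) : Equiv.Perm ℤ :=
  if h : (1 : ZMod (k + 1)) = 0 then 1 else Function.Involutive.toPerm _ (sAffFun_invol k i h)

/-- The Coxeter length of `x`: the least number of simple generators whose product is `x`. -/
noncomputable def affLen (k : ℕ) (x : Equiv.Perm ℤ) : ℕ :=
  sInf {n : ℕ | ∃ w : List (ZMod (k + 1)), w.length = n ∧ x = (w.map (sAff k)).prod}

/-- The right descent set `D_R(x) = {i : ℓ(x s_i) < ℓ(x)}`. -/
noncomputable def rightDescents (k : ℕ) (x : Equiv.Perm ℤ) : Set (ZMod (k + 1)) :=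
  {i | affLen k (x * sAff k i) < affLen k x}

/-- The cyclic interval `[i,j] = {i, i+1, …, j}` of residues mod `k+1`. -/
def cycInt (k : ℕ) (i j : ZMod (k + 1)) : Finset (ZMod (k + 1)) :=
  (Finset.range ((j - i).val + 1)).image fun t : ℕ => i + (t : ZMod (k + 1))

/-- A choice of a "gate" residue not belonging to `A` (when `A` is proper). -/
noncomputable def gate (k : ℕ) (A : Finset (ZMod (k + 1))) : ZMod (k + 1) :=
  if h : ∃ g, g ∉ A then h.choose else 0

/-- The cyclically decreasing element `d_A`: the product of the `s_a`, `a ∈ A`, in an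
order where `s_{a+1}` occurs to the left of `s_a` whenever `a, a+1 ∈ A`. -/
noncomputable def dElt (k : ℕ) (A : Finset (ZMod (k + 1))) : Equiv.Perm ℤ :=
  (((((List.range (k + 1)).reverse.map fun t : ℕ => gate k A + (t : ZMod (k + 1))).filter
      fun a => decide (a ∈ A)).map (sAff k)).prod)

/-- The cyclically increasing element `u_A`: the product of the `s_a`, `a ∈ A`, in an
order where `s_{a+1}` occurs to the right of `s_a` whenever `a, a+1 ∈ A`. -/
noncomputable def uElt (k : ℕ) (A : Finset (ZMod (k + 1))) : Equiv.Perm ℤ :=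
  ((((List.range (k + 1)).map fun t : ℕ => gate k A + (t : ZMod (k + 1))).filter
      fun a => decide (a ∈ A)).map (sAff k)).prod

/-- The right decreasing code: `CRD(x)_i = #{j < ī : x(j) > x(ī)}`. -/
noncomputable def CRD (k : ℕ) (x : Equiv.Perm ℤ) (i : ZMod (k + 1)) : ℕ :=
  Set.ncard {j : ℤ | j < (i.val : ℤ) ∧ x (i.val : ℤ) < x j}

/-- The right increasing code: `CRI(x)_i = #{j > ī + 1 : x(j) < x(ī + 1)}`. -/
noncomputable def CRI (k : ℕ) (x : Equiv.Perm ℤ) (i : ZMod (k + 1)) : ℕ :=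
  Set.ncard {j : ℤ | (i.val : ℤ) + 1 < j ∧ x j < x ((i.val : ℤ) + 1)}

/-- The left decreasing code: `CLD(x)_i = #{j < x⁻¹(ī + 1) : x(j) > ī + 1}`. -/
noncomputable def CLD (k : ℕ) (x : Equiv.Perm ℤ) (i : ZMod (k + 1)) : ℕ :=
  Set.ncard {j : ℤ | j < x.symm ((i.val : ℤ) + 1) ∧ (i.val : ℤ) + 1 < x j}

/-- The left increasing code: `CLI(x)_i = #{j > x⁻¹(ī) : x(j) < ī}`. -/
noncomputable def CLI (k : ℕ) (x : Equiv.Perm ℤ) (i : ZMod (k + 1)) : ℕ :=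
  Set.ncard {j : ℤ | x.symm ((i.val : ℤ)) < j ∧ x j < (i.val : ℤ)}

/-- The product of the simple generators along a word. -/
noncomputable def wordProd (k : ℕ) (w : List (ZMod (k + 1))) : Equiv.Perm ℤ :=
  (w.map (sAff k)).prod

theorem wordProd_cons (k : ℕ) (c : ZMod (k + 1)) (w : List (ZMod (k + 1))) :
    wordProd k (c :: w) = sAff k c * wordProd k w := by
  simp [wordProd]

theorem wordProd_append (k : ℕ) (v w : List (ZMod (k + 1))) :
    wordProd k (v ++ w) = wordProd k v * wordProd k w := by
  simp [wordProd]

theorem one_ne_zero_zmod_succ {k : ℕ} (hk : 1 ≤ k) : ¬ (1 : ZMod (k + 1)) = 0 := by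
  have : Fact (1 < k + 1) := ⟨by omega⟩
  exact one_ne_zero

theorem sAff_apply {k : ℕ} (hk : 1 ≤ k) (c : ZMod (k + 1)) (j : ℤ) :
    sAff k c j = if (j : ZMod (k + 1)) = c then j + 1
      else if (j : ZMod (k + 1)) = c + 1 then j - 1 else j := by
  rw [sAff, dif_neg (one_ne_zero_zmod_succ hk)]
  rfl

theorem sAff_mul_self {k : ℕ} (hk : 1 ≤ k) (c : ZMod (k + 1)) : sAff k c * sAff k c = 1 := by
  ext j
  rw [sAff, dif_neg (one_ne_zero_zmod_succ hk)]
  exact sAffFun_invol k c (one_ne_zero_zmod_succ hk) j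

theorem wordProd_add_mul {k : ℕ} (hk : 1 ≤ k) (w : List (ZMod (k + 1))) (j m : ℤ) :
    wordProd k w (j + m * (k + 1)) = wordProd k w j + m * (k + 1) := by
  have hz : (k : ZMod (k + 1)) + 1 = 0 := by exact_mod_cast ZMod.natCast_self (k + 1)
  induction w with
  | nil => simp [wordProd]
  | cons c w ih =>
    rw [wordProd_cons, Equiv.Perm.mul_apply, Equiv.Perm.mul_apply, ih, sAff_apply hk,
      sAff_apply hk]
    push_cast
    rw [hz, mul_zero, add_zero]
    split_ifs <;> ring

theorem sAff_le_iff {k : ℕ} (hk : 1 ≤ k) {c : ZMod (k + 1)} {b : ℤ}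
    (hb : (b : ZMod (k + 1)) ≠ c) (j : ℤ) : sAff k c j ≤ b ↔ j ≤ b := by
  rw [sAff_apply hk]
  split_ifs with h1 h2
  · have : j ≠ b := by rintro rfl; exact hb h1
    omega
  · have : j ≠ b + 1 := by
      rintro rfl
      push_cast at h2
      exact hb (add_right_cancel h2)
    omega
  · rfl

theorem wordProd_le_iff {k : ℕ} (hk : 1 ≤ k) {w : List (ZMod (k + 1))} {b : ℤ}
    (hb : (b : ZMod (k + 1)) ∉ w) (j : ℤ) : wordProd k w j ≤ b ↔ j ≤ b := by
  induction w with
  | nil => simp [wordProd]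
  | cons c w ih =>
    rw [List.mem_cons, not_or] at hb
    rw [wordProd_cons, Equiv.Perm.mul_apply, sAff_le_iff hk hb.1, ih hb.2]

/-- Conjugation: if `w` sends `i, i + 1` to `j, j + 1`, it intertwines `s_i` and `s_j`. -/
theorem wordProd_mul_sAff {k : ℕ} (hk : 1 ≤ k) (w : List (ZMod (k + 1))) (i : ℤ)
    (h : wordProd k w (i + 1) = wordProd k w i + 1) :
    wordProd k w * sAff k i = sAff k (wordProd k w i : ℤ) * wordProd k w := by
  have hz : (k : ZMod (k + 1)) + 1 = 0 := by exact_mod_cast ZMod.natCast_self (k + 1)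
  have key : ∀ a b : ℤ, (a : ZMod (k + 1)) = b → ∃ m : ℤ, a = b + m * (k + 1) := by
    intro a b hab
    obtain ⟨m, hm⟩ := (ZMod.intCast_eq_intCast_iff_dvd_sub b a (k + 1)).1 hab.symm
    refine ⟨m, ?_⟩
    push_cast at hm
    linarith
  have hiff : ∀ a b : ℤ, ((wordProd k w a : ℤ) : ZMod (k + 1)) = (wordProd k w b : ℤ) ↔
      (a : ZMod (k + 1)) = b := by
    intro a b
    constructor
    · intro hab
      obtain ⟨m, hm⟩ := key _ _ hab
      rw [← wordProd_add_mul hk] at hm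
      rw [(wordProd k w).injective hm]
      push_cast
      rw [hz]
      ring
    · intro hab
      obtain ⟨m, rfl⟩ := key _ _ hab
      rw [wordProd_add_mul hk]
      push_cast
      rw [hz]
      ring
  ext j
  rw [Equiv.Perm.mul_apply, Equiv.Perm.mul_apply, sAff_apply hk, sAff_apply hk]
  have h1 := hiff j i
  have h2 := hiff j (i + 1)
  rw [h] at h2
  push_cast at h2
  simp only [h1, h2]
  split_ifs with c1 c2
  · obtain ⟨m, rfl⟩ := key _ _ c1
    rw [show i + m * (k + 1) + 1 = (i + 1) + m * (k + 1) by ring, wordProd_add_mul hk,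
      wordProd_add_mul hk, h]
    ring
  · obtain ⟨m, rfl⟩ := key j (i + 1) (by push_cast; exact c2)
    rw [show i + 1 + m * (k + 1) - 1 = i + m * (k + 1) by ring, wordProd_add_mul hk,
      wordProd_add_mul hk, h]
    ring
  · rfl

/-- The exchange property. -/
theorem exists_wordProd_eq_mul_sAff {k : ℕ} (hk : 1 ≤ k) (w : List (ZMod (k + 1))) (i : ℤ)
    (h : wordProd k w (i + 1) < wordProd k w i) :
    ∃ w', w'.length + 1 = w.length ∧ wordProd k w' = wordProd k w * sAff k i := by
  induction w with
  | nil => simp [wordProd] at h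
  | cons c w ih =>
    rcases lt_or_ge (wordProd k w (i + 1)) (wordProd k w i) with hlt | hge
    · obtain ⟨w', hl, hw⟩ := ih hlt
      exact ⟨c :: w', by simp [hl], by rw [wordProd_cons, wordProd_cons, hw, mul_assoc]⟩
    · have hne : wordProd k w i ≠ wordProd k w (i + 1) := fun he => by
        have := (wordProd k w).injective he
        omega
      have hc : ((wordProd k w i : ℤ) : ZMod (k + 1)) = c := by
        by_contra hc
        rw [wordProd_cons, Equiv.Perm.mul_apply, Equiv.Perm.mul_apply] at h
        have h1 := sAff_le_iff hk hc (wordProd k w i)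
        have h2 := sAff_le_iff hk hc (wordProd k w (i + 1))
        omega
      have hs : wordProd k w (i + 1) = wordProd k w i + 1 := by
        rw [wordProd_cons, Equiv.Perm.mul_apply, Equiv.Perm.mul_apply, sAff_apply hk c
          (wordProd k w i), if_pos hc, sAff_apply hk] at h
        split_ifs at h <;> omega
      refine ⟨w, rfl, ?_⟩
      rw [wordProd_cons, mul_assoc, wordProd_mul_sAff hk w i hs, hc, ← mul_assoc,
        sAff_mul_self hk, one_mul]

theorem affLen_wordProd_le (k : ℕ) (w : List (ZMod (k + 1))) :
    affLen k (wordProd k w) ≤ w.length :=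
  Nat.sInf_le ⟨w, rfl, rfl⟩

theorem affLen_mul_wordProd_le (k : ℕ) (v w : List (ZMod (k + 1))) :
    affLen k (wordProd k v * wordProd k w) ≤ affLen k (wordProd k v) + w.length := by
  obtain ⟨u, hu, he⟩ := Nat.sInf_mem
    (s := {n : ℕ | ∃ u : List (ZMod (k + 1)), u.length = n ∧
      wordProd k v = (u.map (sAff k)).prod}) ⟨_, v, rfl, rfl⟩
  change u.length = affLen k (wordProd k v) at hu
  rw [← hu, ← List.length_append]
  refine Nat.sInf_le ⟨u ++ w, rfl, ?_⟩
  rw [he]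
  simp [wordProd]

/-- In a reduced word, every letter contributes an inversion. -/
theorem exists_inversion_of_reduced {k : ℕ} (hk : 1 ≤ k) (u v : List (ZMod (k + 1))) (c : ℤ)
    (hred : (u ++ (c : ZMod (k + 1)) :: v).length ≤
      affLen k (wordProd k (u ++ (c : ZMod (k + 1)) :: v)))
    (p q : ℤ) (hp : wordProd k v p = c) (hq : wordProd k v q = c + 1) :
    wordProd k (u ++ (c : ZMod (k + 1)) :: v) q < wordProd k (u ++ (c : ZMod (k + 1)) :: v) p := by
  have hlt : wordProd k u c < wordProd k u (c + 1) := by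
    by_contra hcon
    have hne : wordProd k u (c + 1) ≠ wordProd k u c := fun he => by
      have := (wordProd k u).injective he
      omega
    obtain ⟨u', hl, hu⟩ := exists_wordProd_eq_mul_sAff hk u c (by omega)
    have h1 : wordProd k (u ++ (c : ZMod (k + 1)) :: v) = wordProd k (u' ++ v) := by
      rw [wordProd_append, wordProd_append, wordProd_cons, hu, mul_assoc]
    rw [h1] at hred
    have h2 := affLen_wordProd_le k (u' ++ v)
    simp only [List.length_append, List.length_cons] at hred h2
    omega
  have hone := one_ne_zero_zmod_succ hk
  rw [wordProd_append, wordProd_cons]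
  simp only [Equiv.Perm.mul_apply, hp, hq, sAff_apply hk]
  simpa [hone] using hlt

/-- The initial part, in order of application, of the word of `d_A`. -/
noncomputable def dWordUpTo (k : ℕ) (A : Finset (ZMod (k + 1))) (n : ℕ) : List (ZMod (k + 1)) :=
  ((List.range n).reverse.map fun t : ℕ => gate k A + (t : ZMod (k + 1))).filter
    fun a => decide (a ∈ A)

theorem dElt_eq_wordProd (k : ℕ) (A : Finset (ZMod (k + 1))) :
    dElt k A = wordProd k (dWordUpTo k A (k + 1)) := rfl

theorem dWordUpTo_succ (k : ℕ) (A : Finset (ZMod (k + 1))) (n : ℕ) :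
    dWordUpTo k A (n + 1) = if gate k A + n ∈ A then (gate k A + n) :: dWordUpTo k A n
      else dWordUpTo k A n := by
  simp [dWordUpTo, List.range_succ, List.filter_cons]

theorem mem_dWordUpTo {k : ℕ} {A : Finset (ZMod (k + 1))} {n : ℕ} {a : ZMod (k + 1)} :
    a ∈ dWordUpTo k A n ↔ (∃ t < n, gate k A + (t : ZMod (k + 1)) = a) ∧ a ∈ A := by
  simp [dWordUpTo]

theorem gate_notMem {k : ℕ} {A : Finset (ZMod (k + 1))} (hA : A ≠ Finset.univ) :
    gate k A ∉ A := by
  have h : ∃ g, g ∉ A := by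
    by_contra! h
    exact hA (Finset.eq_univ_iff_forall.2 h)
  rw [gate, dif_pos h]
  exact h.choose_spec

theorem exists_gate_add {k : ℕ} (A : Finset (ZMod (k + 1))) (a : ZMod (k + 1)) :
    ∃ t < k + 1, gate k A + (t : ZMod (k + 1)) = a :=
  ⟨(a - gate k A).val, ZMod.val_lt _, by rw [ZMod.natCast_zmod_val]; ring⟩

theorem mem_dWord {k : ℕ} {A : Finset (ZMod (k + 1))} {a : ZMod (k + 1)} :
    a ∈ dWordUpTo k A (k + 1) ↔ a ∈ A := by
  rw [mem_dWordUpTo, and_iff_right (exists_gate_add A a)]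

theorem natCast_zmod_succ_inj {k s t : ℕ} (hs : s < k + 1) (ht : t < k + 1)
    (h : (s : ZMod (k + 1)) = t) : s = t := by
  rw [ZMod.natCast_eq_natCast_iff'] at h
  rwa [Nat.mod_eq_of_lt hs, Nat.mod_eq_of_lt ht] at h

theorem length_dWord (k : ℕ) (A : Finset (ZMod (k + 1))) :
    (dWordUpTo k A (k + 1)).length = A.card := by
  have hnd : (dWordUpTo k A (k + 1)).Nodup := by
    refine List.Nodup.filter _ (List.Nodup.map_on ?_ (List.nodup_reverse.2 List.nodup_range))
    intro s hs t ht hst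
    simp only [List.mem_reverse, List.mem_range] at hs ht
    exact natCast_zmod_succ_inj hs ht (add_left_cancel hst)
  rw [← List.toFinset_card_of_nodup hnd]
  congr 1
  ext a
  rw [List.mem_toFinset, mem_dWord]

theorem gate_add_notMem_dWordUpTo {k : ℕ} {A : Finset (ZMod (k + 1))} {n : ℕ} (hn : n < k + 1) :
    gate k A + n ∉ dWordUpTo k A n := by
  rw [mem_dWordUpTo]
  rintro ⟨⟨t, ht, he⟩, -⟩
  have := natCast_zmod_succ_inj (by omega) hn (add_left_cancel he)
  omega

theorem gate_add_succ_notMem_dWordUpTo {k : ℕ} {A : Finset (ZMod (k + 1))}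
    (hA : A ≠ Finset.univ) {n : ℕ} (hn : n < k + 1) :
    gate k A + n + 1 ∉ dWordUpTo k A n := by
  rw [mem_dWordUpTo]
  rintro ⟨⟨t, ht, he⟩, hmem⟩
  rw [add_assoc] at he hmem
  rcases Nat.lt_or_ge (n + 1) (k + 1) with hlt | hge
  · have he' : ((t : ℕ) : ZMod (k + 1)) = ((n + 1 : ℕ) : ZMod (k + 1)) := by
      push_cast
      exact add_left_cancel he
    have := natCast_zmod_succ_inj (by omega) hlt he'
    omega
  · obtain rfl : n = k := by omega
    have hz : (n : ZMod (n + 1)) + 1 = 0 := by exact_mod_cast ZMod.natCast_self (n + 1)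
    rw [hz, add_zero] at hmem
    exact gate_notMem hA hmem

theorem wordProd_fixes {k : ℕ} (hk : 1 ≤ k) (w : List (ZMod (k + 1))) (j : ℤ)
    (h0 : (j : ZMod (k + 1)) ∉ w) (h1 : (j : ZMod (k + 1)) - 1 ∉ w) : wordProd k w j = j := by
  have a := wordProd_le_iff hk h0 j
  have b := wordProd_le_iff hk (b := j - 1) (w := w) (by push_cast; exact h1) j
  omega

/-- If `v d_B` is reduced, every `c ∈ B` yields an inversion ending at position `c + 1`. -/
theorem exists_inversion_of_mem {k : ℕ} (hk : 1 ≤ k) {B : Finset (ZMod (k + 1))}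
    (hB : B ≠ Finset.univ) (v : List (ZMod (k + 1)))
    (hred : v.length + B.card ≤ affLen k (wordProd k v * dElt k B))
    (c : ℤ) (hc : (c : ZMod (k + 1)) ∈ B) :
    ∃ p < c + 1, (wordProd k v * dElt k B) (c + 1) < (wordProd k v * dElt k B) p := by
  obtain ⟨t, ht, hct⟩ := exists_gate_add B (c : ZMod (k + 1))
  have hsplit : ∀ n, t < n →
      ∃ u, dWordUpTo k B n = u ++ (c : ZMod (k + 1)) :: dWordUpTo k B t := by
    intro n hn
    induction n, hn using Nat.le_induction with
    | base => exact ⟨[], by rw [dWordUpTo_succ, hct, if_pos hc]; rfl⟩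
    | succ n hn ih =>
      obtain ⟨u, hu⟩ := ih
      rw [dWordUpTo_succ, hu]
      split_ifs
      · exact ⟨_ :: u, rfl⟩
      · exact ⟨u, rfl⟩
  obtain ⟨u, hu⟩ := hsplit (k + 1) ht
  have h0 : (c : ZMod (k + 1)) ∉ dWordUpTo k B t := hct ▸ gate_add_notMem_dWordUpTo ht
  have h1 : (c : ZMod (k + 1)) + 1 ∉ dWordUpTo k B t := hct ▸ gate_add_succ_notMem_dWordUpTo hB ht
  have hw : wordProd k v * dElt k B
      = wordProd k ((v ++ u) ++ (c : ZMod (k + 1)) :: dWordUpTo k B t) := by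
    rw [dElt_eq_wordProd, hu, List.append_assoc, ← wordProd_append]
  have hlen : ((v ++ u) ++ (c : ZMod (k + 1)) :: dWordUpTo k B t).length
      = v.length + B.card := by
    rw [List.append_assoc, ← hu, List.length_append, length_dWord]
  rw [hw] at hred ⊢
  refine ⟨(wordProd k (dWordUpTo k B t)).symm c, ?_, ?_⟩
  · have := wordProd_le_iff hk h0 ((wordProd k (dWordUpTo k B t)).symm c)
    rw [Equiv.apply_symm_apply] at this
    omega
  · refine exists_inversion_of_reduced hk (v ++ u) _ c (hlen.trans_le hred) _ _
      (Equiv.apply_symm_apply _ _) (wordProd_fixes hk _ _ ?_ ?_)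
    · push_cast
      exact h1
    · push_cast
      rw [add_sub_cancel_right]
      exact h0

theorem dElt_apply_notMem {k : ℕ} (hk : 1 ≤ k) {A : Finset (ZMod (k + 1))}
    (hA : A ≠ Finset.univ) (p : ℤ) (hp : (p : ZMod (k + 1)) - 1 ∉ A) :
    ((dElt k A p : ℤ) : ZMod (k + 1)) ∉ A := by
  have key : ∀ n ≤ k + 1,
      ((wordProd k (dWordUpTo k A n) p : ℤ) : ZMod (k + 1)) ∉ dWordUpTo k A n ∧
      (((wordProd k (dWordUpTo k A n) p : ℤ) : ZMod (k + 1)) - 1 ∈ A →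
        ((wordProd k (dWordUpTo k A n) p : ℤ) : ZMod (k + 1)) - 1 ∈ dWordUpTo k A n) := by
    intro n
    induction n with
    | zero => simp [dWordUpTo, wordProd, hp]
    | succ n ih =>
      intro hn
      obtain ⟨ih1, ih2⟩ := ih (by omega)
      rw [dWordUpTo_succ]
      split_ifs with hmem
      · have g0 := gate_add_notMem_dWordUpTo (A := A) (n := n) (by omega)
        have g1 := gate_add_succ_notMem_dWordUpTo hA (n := n) (by omega)
        rw [wordProd_cons, Equiv.Perm.mul_apply, sAff_apply hk]
        generalize wordProd k (dWordUpTo k A n) p = q at ih1 ih2 ⊢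
        split_ifs with c1 c2
        · push_cast
          rw [c1]
          simp [one_ne_zero_zmod_succ hk, g1]
        · rw [c2, add_sub_cancel_right] at ih2
          exact absurd (ih2 hmem) g0
        · exact ⟨by simp [c1, ih1], fun h => List.mem_cons_of_mem _ (ih2 h)⟩
      · exact ⟨ih1, ih2⟩
  have := (key (k + 1) le_rfl).1
  rwa [mem_dWord] at this

/-- Positions outside `A₁ + 1` end no inversion of the canonical product. -/
theorem lt_of_chain {k : ℕ} (hk : 1 ≤ k) (L : List (Finset (ZMod (k + 1))))
    (hL : ∀ A ∈ L, A ≠ Finset.univ)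
    (hchain : L.IsChain (fun A B => B ⊆ A.image (fun a => a - 1)))
    (p : ℤ) (hp : ∀ A ∈ L.head?, (p : ZMod (k + 1)) - 1 ∉ A) (j : ℤ) (hj : j < p) :
    (L.reverse.map (dElt k)).prod j < (L.reverse.map (dElt k)).prod p := by
  induction L generalizing p j with
  | nil => simpa using hj
  | cons A L ih =>
    have hpA : (p : ZMod (k + 1)) - 1 ∉ A := hp A (by simp)
    have hbound : ∀ i, dElt k A i ≤ p - 1 ↔ i ≤ p - 1 := by
      intro i
      rw [dElt_eq_wordProd]
      refine wordProd_le_iff hk ?_ i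
      rw [mem_dWord]
      push_cast
      exact hpA
    have h1 := hbound j
    have h2 := hbound p
    simp only [List.reverse_cons, List.map_append, List.prod_append, List.map_cons, List.map_nil,
      List.prod_cons, List.prod_nil, mul_one, Equiv.Perm.mul_apply]
    refine ih (fun C hC => hL C (by simp [hC])) hchain.tail _ ?_ _ (by omega)
    intro C hC hmem
    rw [List.isChain_cons] at hchain
    obtain ⟨a, ha, hae⟩ := Finset.mem_image.1 (hchain.1 C hC hmem)
    rw [sub_left_inj] at hae
    exact dElt_apply_notMem hk (hL A (by simp)) p hpA (hae ▸ ha)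

theorem exists_word_of_dElt_prod (k : ℕ) (L : List (Finset (ZMod (k + 1)))) :
    ∃ w, (L.reverse.map (dElt k)).prod = wordProd k w ∧ w.length = (L.map Finset.card).sum := by
  induction L with
  | nil => exact ⟨[], by simp [wordProd]⟩
  | cons A L ih =>
    obtain ⟨w, hw, hl⟩ := ih
    refine ⟨w ++ dWordUpTo k A (k + 1), ?_, ?_⟩
    · simp [← hw, wordProd_append, dElt_eq_wordProd]
    · simp [hl, length_dWord, add_comm]

theorem eq_of_isChain_of_prod_eq {k : ℕ} (hk : 1 ≤ k) (L M : List (Finset (ZMod (k + 1))))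
    (hL : ∀ A ∈ L, A ≠ Finset.univ)
    (hchain : L.IsChain (fun A B => B ⊆ A.image (fun a => a - 1)))
    (hM : ∀ B ∈ M, B ≠ Finset.univ)
    (hprod : (M.reverse.map (dElt k)).prod = (L.reverse.map (dElt k)).prod)
    (hlen : (L.map Finset.card).sum ≤ affLen k (L.reverse.map (dElt k)).prod)
    (hcard : M.map Finset.card = L.map Finset.card) : M = L := by
  induction L generalizing M with
  | nil => simpa using hcard
  | cons A L ih =>
    obtain - | ⟨B, M⟩ := M
    · simp at hcard
    simp only [List.map_cons, List.cons.injEq] at hcard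
    obtain ⟨hAB, hcard⟩ := hcard
    obtain ⟨v, hv, hvl⟩ := exists_word_of_dElt_prod k M
    obtain ⟨w, hw, hwl⟩ := exists_word_of_dElt_prod k L
    have hsub : B ⊆ A := by
      intro b hb
      obtain ⟨c, rfl⟩ := ZMod.intCast_surjective b
      by_contra hcA
      have hMB : ((B :: M).reverse.map (dElt k)).prod = wordProd k v * dElt k B := by
        simp [← hv]
      obtain ⟨p, hp, hinv⟩ := exists_inversion_of_mem hk (hM B (by simp)) v
        (by
          rw [← hMB, hprod, hvl, hcard, hAB]
          simpa [add_comm] using hlen) c hb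
      have hlt := lt_of_chain hk (A :: L) hL hchain (c + 1) (by simpa using hcA) p hp
      rw [← hprod, hMB] at hlt
      exact lt_asymm hlt hinv
    obtain rfl : B = A := Finset.eq_of_subset_of_card_le hsub hAB.ge
    simp only [List.reverse_cons, List.map_append, List.prod_append, List.map_cons, List.map_nil,
      List.prod_cons, List.prod_nil, mul_one, List.sum_cons] at hprod hlen
    rw [ih M (fun C hC => hL C (by simp [hC])) hchain.tail (fun C hC => hM C (by simp [hC]))
      (mul_right_cancel hprod) ?_ hcard]
    have hle := affLen_mul_wordProd_le k w (dWordUpTo k B (k + 1))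
    rw [← dElt_eq_wordProd, ← hw, length_dWord] at hle
    omega

/-- the canonical maximal decomposition is the unique reduced
cyclically decreasing decomposition of its shape. -/
theorem unique_decomposition_of_max_shape (k : ℕ) (hk : 1 ≤ k) (x : Equiv.Perm ℤ)
    (hx : IsAffinePerm k x) (L M : List (Finset (ZMod (k + 1))))
    (hL : ∀ A ∈ L, A.Nonempty ∧ A ≠ Finset.univ)
    (hLchain : List.Chain' (fun A B => B ⊆ A.image (fun a => a - 1)) L)
    (hLprod : x = (L.reverse.map (dElt k)).prod)
    (hLlen : affLen k x = (L.map Finset.card).sum)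
    (hM : ∀ B ∈ M, B ≠ Finset.univ)
    (hMprod : x = (M.reverse.map (dElt k)).prod)
    (hMlen : affLen k x = (M.map Finset.card).sum)
    (hcard : M.map Finset.card = L.map Finset.card) :
    M = L := by
  subst hLprod
  exact eq_of_isChain_of_prod_eq hk L M (fun A hA => (hL A hA).2) hLchain hM hMprod.symm hLlen.ge hcard
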